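/- arXiv:1711.03505 — 4 statements merged into one kernel-verified Lean document; each statement's English description precedes it below -/
import Mathlib

section
/- Let m and a be coprime integers with m > 1 and 0 < a < m, let p be a prime not dividing m, and let σ be a field automorphism of ℚ̄ fixing every m-th root of unity; set c := χ_p(σ) ∈ ℤ_pˣ. Then there exists a ℤ_p-valued measure μ on ℤ_p such that for every integer k ≥ 1, ∫_{ℤ_pˣ} b^{k−1} dμ(b) (i.e., μ applied to the continuous function b ↦ b^{k−1}·1_{ℤ_pˣ}(b)) equals (1 − c^k) · m^{k−1} · ( (1/k)·B_k(a/m) − (p^{k−1}/k)·B_k(⟨ap⁻¹⟩/m) ), viewed in ℚ_p. -/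
open Filter Topology in
/-- Uniformly bounded `ℤ_p`-integral functionals have a limit along an ultrafilter, which computes
every ordinary limit that exists. -/
theorem exists_integral_limit_functional {p : ℕ} [Fact p.Prime]
    (S : ℕ → C(ℤ_[p], ℚ_[p]) →ₗ[ℚ_[p]] ℚ_[p])
    (hS : ∀ n f (C : ℝ), (∀ x, ‖f x‖ ≤ C) → ‖S n f‖ ≤ C) :
    ∃ μ : C(ℤ_[p], ℚ_[p]) →ₗ[ℚ_[p]] ℚ_[p],
      (∀ f : C(ℤ_[p], ℚ_[p]), (∀ x, ‖f x‖ ≤ 1) → ‖μ f‖ ≤ 1) ∧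
      ∀ f l, Tendsto (fun n ↦ S n f) atTop (𝓝 l) → μ f = l := by
  let U : Ultrafilter ℕ := hyperfilter ℕ
  have hlim : ∀ f, ∃ l, Tendsto (fun n ↦ S n f) U (𝓝 l) := by
    intro f
    have hmem : ∀ n, S n f ∈ Metric.closedBall (0 : ℚ_[p]) ‖f‖ := fun n ↦ by
      simpa using hS n f ‖f‖ f.norm_coe_le_norm
    obtain ⟨l, -, hl⟩ := (isCompact_closedBall (0 : ℚ_[p]) ‖f‖).ultrafilter_le_nhds'
      (U.map fun n ↦ S n f) (Filter.Eventually.of_forall (f := (U : Filter ℕ)) hmem)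
    exact ⟨l, hl⟩
  choose L hL using hlim
  refine ⟨{ toFun := L, map_add' := fun f g ↦ ?_, map_smul' := fun r f ↦ ?_ }, fun f hf ↦ ?_,
    fun f l hl ↦ ?_⟩
  · refine tendsto_nhds_unique (hL (f + g)) ?_
    simpa using (hL f).add (hL g)
  · refine tendsto_nhds_unique (hL (r • f)) ?_
    simpa using (hL f).const_mul r
  · exact le_of_tendsto (hL f).norm (Filter.Eventually.of_forall fun n ↦ hS n f 1 hf)
  · exact tendsto_nhds_unique (hL f) (hl.mono_left Nat.hyperfilter_le_atTop)

theorem sum_range_add_pow_mul_eq_bernoulli_sub (x : ℚ) (k N : ℕ) :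
    (∑ j ∈ Finset.range N, (x + j) ^ k) * (k + 1) =
      (Polynomial.bernoulli (k + 1)).eval (x + N) - (Polynomial.bernoulli (k + 1)).eval x := by
  induction N with
  | zero => simp
  | succ N ih =>
    have h := Polynomial.bernoulli_eval_one_add (k + 1) (x + N)
    rw [Finset.sum_range_succ, add_mul, ih]
    rw [show x + ((N + 1 : ℕ) : ℚ) = 1 + (x + N) by push_cast; ring, h]
    push_cast
    ring

open Filter Topology in
theorem tendsto_padic_pow_atTop_zero {p : ℕ} [Fact p.Prime] :
    Tendsto (fun n : ℕ ↦ (p : ℚ_[p]) ^ n) atTop (𝓝 0) :=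
  tendsto_pow_atTop_nhds_zero_of_norm_lt_one Padic.norm_p_lt_one

open Filter Topology in
/-- Averages of `k`-th powers over an initial segment of length `p ^ n` of an arithmetic
progression with step one converge `p`-adically to the value of the Bernoulli polynomial. -/
theorem tendsto_sum_range_pow_div_bernoulli {p : ℕ} [hp : Fact p.Prime] (x : ℚ) (k : ℕ) :
    Tendsto (fun n : ℕ ↦
        (∑ j ∈ Finset.range (p ^ n), ((x : ℚ_[p]) + (j : ℚ_[p])) ^ k) / (p : ℚ_[p]) ^ n)
      atTop (𝓝 (((Polynomial.bernoulli k).eval x : ℚ) : ℚ_[p])) := by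
  have hp0 : (p : ℚ_[p]) ≠ 0 := Nat.cast_ne_zero.2 hp.out.ne_zero
  have hk0 : ((k : ℚ_[p]) + 1) ≠ 0 := by exact_mod_cast Nat.succ_ne_zero k
  let Q : Polynomial ℚ_[p] := (Polynomial.bernoulli (k + 1)).map (algebraMap ℚ ℚ_[p])
  have hQ : ∀ y : ℚ, Q.eval (y : ℚ_[p]) =
      (((Polynomial.bernoulli (k + 1)).eval y : ℚ) : ℚ_[p]) := fun y ↦ by
    have := Polynomial.eval_map_apply (algebraMap ℚ ℚ_[p]) y (p := Polynomial.bernoulli (k + 1))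
    simpa [Q] using this
  have hQ' : Q.derivative.eval (x : ℚ_[p]) =
      ((k : ℚ_[p]) + 1) * (((Polynomial.bernoulli k).eval x : ℚ) : ℚ_[p]) := by
    have := Polynomial.eval_map_apply (algebraMap ℚ ℚ_[p]) x
      (p := (Polynomial.bernoulli (k + 1)).derivative)
    rw [Polynomial.derivative_map]
    refine Eq.trans (by simpa using this) ?_
    rw [Polynomial.derivative_bernoulli_add_one]
    simp
  have hslope := (hasDerivAt_iff_tendsto_slope_zero.1 (Q.hasDerivAt (x : ℚ_[p])))
  have hpn : Tendsto (fun n : ℕ ↦ (p : ℚ_[p]) ^ n) atTop (𝓝[≠] 0) :=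
    tendsto_nhdsWithin_iff.2 ⟨tendsto_padic_pow_atTop_zero,
      Filter.Eventually.of_forall fun n ↦ pow_ne_zero n hp0⟩
  have h := (hslope.comp hpn).div_const ((k : ℚ_[p]) + 1)
  rw [hQ', mul_div_cancel_left₀ _ hk0] at h
  refine h.congr fun n ↦ ?_
  have hsum := congrArg (fun q : ℚ ↦ (q : ℚ_[p]))
    (sum_range_add_pow_mul_eq_bernoulli_sub x k (p ^ n))
  push_cast at hsum
  have h1 := hQ (x + (p : ℚ) ^ n)
  push_cast at h1
  simp only [Function.comp_apply, smul_eq_mul]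
  rw [h1, hQ x, ← hsum]
  field_simp

/-- A sum over `range (p * N)` of a function supported on one residue class modulo `p`. -/
theorem sum_range_mul_ite_mod {M : Type*} [AddCommMonoid M] {p j₀ : ℕ} (hj₀ : j₀ < p) (N : ℕ)
    (F : ℕ → M) :
    ∑ j ∈ Finset.range (p * N), (if j % p = j₀ then F j else 0) =
      ∑ i ∈ Finset.range N, F (p * i + j₀) := by
  induction N with
  | zero => simp
  | succ N ih =>
    rw [mul_add, mul_one, Finset.sum_range_add, ih, Finset.sum_range_succ]
    congr 1
    rw [Finset.sum_eq_single_of_mem j₀ (Finset.mem_range.2 hj₀)]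
    · simp [Nat.mod_eq_of_lt hj₀]
    · intro b hb hne
      rw [if_neg]
      simpa [Nat.mod_eq_of_lt (Finset.mem_range.1 hb)] using hne

/-- For an integer `m` prime to `p`, multiplication by a `p`-adic unit permutes the residues
modulo `p ^ n` of the progression `a + m j`. -/
theorem exists_perm_progression {p : ℕ} [hp : Fact p.Prime] {m : ℕ} (hpm : ¬ p ∣ m) (a : ℕ)
    (c : ℤ_[p]ˣ) (n : ℕ) :
    ∃ π : Equiv.Perm (ZMod (p ^ n)), ∃ t : ZMod (p ^ n) → ℤ_[p], ∀ z,
      ((a + m * z.val : ℕ) : ℤ_[p]) = c * ((a + m * (π z).val : ℕ) : ℤ_[p]) + p ^ n * t z := by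
  have hcop : Nat.Coprime m (p ^ n) :=
    Nat.Coprime.pow_right n ((Nat.Prime.coprime_iff_not_dvd hp.out).2 hpm).symm
  let u : (ZMod (p ^ n))ˣ := ZMod.unitOfCoprime m hcop
  let d : (ZMod (p ^ n))ˣ := Units.map (PadicInt.toZModPow n : ℤ_[p] →+* ZMod (p ^ n)) c
  have hu : (u : ZMod (p ^ n)) = m := ZMod.coe_unitOfCoprime m hcop
  let e : Equiv.Perm (ZMod (p ^ n)) := (Units.mulLeft u).trans (Equiv.addLeft (a : ZMod (p ^ n)))
  have he : ∀ z, e z = a + m * z := fun z ↦ by simp [e, hu]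
  let π : Equiv.Perm (ZMod (p ^ n)) := (e.trans (Units.mulLeft d⁻¹)).trans e.symm
  have hπ : ∀ z, e z = d * e (π z) := fun z ↦ by simp [π]
  have hex : ∀ z, ∃ t : ℤ_[p],
      ((a + m * z.val : ℕ) : ℤ_[p]) = c * ((a + m * (π z).val : ℕ) : ℤ_[p]) + p ^ n * t := by
    intro z
    have hker : ((a + m * z.val : ℕ) : ℤ_[p]) - c * ((a + m * (π z).val : ℕ) : ℤ_[p]) ∈
        RingHom.ker (PadicInt.toZModPow n : ℤ_[p] →+* ZMod (p ^ n)) := by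
      have := hπ z
      rw [he, he] at this
      rw [RingHom.mem_ker, map_sub, map_mul, map_natCast, map_natCast, sub_eq_zero]
      push_cast
      rw [ZMod.natCast_zmod_val, ZMod.natCast_zmod_val, this]
      rfl
    rw [PadicInt.ker_toZModPow, Ideal.mem_span_singleton] at hker
    obtain ⟨t, ht⟩ := hker
    exact ⟨t, by rw [← ht]; ring⟩
  choose t ht using hex
  exact ⟨π, t, ht⟩

theorem ZMod.sum_val_eq_sum_range {M : Type*} [AddCommMonoid M] (N : ℕ) [NeZero N] (F : ℕ → M) :
    ∑ z : ZMod N, F z.val = ∑ j ∈ Finset.range N, F j := by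
  refine Finset.sum_nbij' (fun z ↦ z.val) (fun j ↦ (j : ZMod N)) ?_ ?_ ?_ ?_ ?_
  · exact fun z _ ↦ Finset.mem_range.2 z.val_lt
  · simp
  · simp
  · exact fun j hj ↦ ZMod.val_cast_of_lt (Finset.mem_range.1 hj)
  · simp

theorem ZMod.sub_one_eq_zero_of_ne_zero : ∀ y : ZMod 2, y ≠ 0 → y - 1 = 0 := by decide

theorem PadicInt.norm_unit_sub_one_div_two_le {p : ℕ} [hp : Fact p.Prime] (c : ℤ_[p]ˣ) :
    ‖(((c : ℤ_[p]) : ℚ_[p]) - 1) / 2‖ ≤ 1 := by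
  have hcast : ‖((c : ℤ_[p]) : ℚ_[p]) - 1‖ = ‖(c : ℤ_[p]) - 1‖ := by
    rw [PadicInt.norm_def]; push_cast; rfl
  by_cases h2 : p = 2
  · subst h2
    have h : (c : ℤ_[2]) - 1 ∈ RingHom.ker (PadicInt.toZMod : ℤ_[2] →+* ZMod 2) := by
      have hc : PadicInt.toZMod (c : ℤ_[2]) ≠ 0 := (c.isUnit.map PadicInt.toZMod).ne_zero
      rw [RingHom.mem_ker, map_sub, map_one]
      exact ZMod.sub_one_eq_zero_of_ne_zero _ hc
    rw [PadicInt.ker_toZMod, PadicInt.maximalIdeal_eq_span_p, Ideal.mem_span_singleton] at h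
    obtain ⟨y, hy⟩ := h
    have : ((c : ℤ_[2]) : ℚ_[2]) - 1 = 2 * (y : ℚ_[2]) := by
      have := congrArg (fun x : ℤ_[2] ↦ (x : ℚ_[2])) hy
      push_cast at this
      exact this
    rw [this, mul_div_cancel_left₀ _ two_ne_zero]
    exact y.norm_le_one
  · have : ‖(2 : ℚ_[p])‖ = 1 := by
      have := (Padic.norm_natCast_eq_one_iff (p := p) (n := 2)).2
        ((Nat.coprime_primes hp.out Nat.prime_two).2 h2)
      simpa using this
    rw [norm_div, this, div_one, hcast]
    exact PadicInt.norm_le_one _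

/-- The function `x ↦ x ^ k` on natural numbers prime to `p`, extended by zero. -/
noncomputable def primeToPow (p : ℕ) [Fact p.Prime] (k x : ℕ) : ℚ_[p] :=
  if p ∣ x then 0 else (x : ℚ_[p]) ^ k

theorem exists_mul_eq_add_mul {m a p a₁ : ℕ} (hm : 1 < m) (ha : 0 < a) (ham : a < m)
    (hp : 0 < p)
    (ha₁ : 0 < a₁) (ha₁p : ((a₁ : ℤ) * p) ≡ a [ZMOD (m : ℤ)])
    (ha₁min : ∀ x : ℕ, 0 < x → ((x : ℤ) * p) ≡ a [ZMOD (m : ℤ)] → a₁ ≤ x) :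
    ∃ j₀ < p, p * a₁ = a + m * j₀ := by
  have ha₁m : a₁ ≤ m := by
    by_contra! hlt
    have := ha₁min (a₁ - m) (by omega) (by
      refine Int.ModEq.trans ?_ ha₁p
      rw [Nat.cast_sub hlt.le]
      exact Int.modEq_iff_dvd.2 ⟨p, by ring⟩)
    omega
  obtain ⟨q, hq⟩ := Int.modEq_iff_dvd.1 ha₁p.symm
  have hq0 : 0 ≤ q := by
    by_contra! hneg
    have : (0 : ℤ) < a₁ * p := by positivity
    nlinarith
  lift q to ℕ using hq0
  refine ⟨q, ?_, ?_⟩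
  · have h1 : m * q < m * p := by
      zify
      rw [← hq]
      have : (a₁ : ℤ) * p ≤ m * p := by gcongr
      omega
    exact lt_of_mul_lt_mul_left h1 (Nat.zero_le m)
  · zify
    linarith

open Filter Topology in
theorem tendsto_sum_range_primeToPow {p : ℕ} [hp : Fact p.Prime] {m a a₁ j₀ : ℕ} (hm : 0 < m)
    (hpm : ¬ p ∣ m) (hj₀ : j₀ < p) (h : p * a₁ = a + m * j₀) (k : ℕ) :
    Tendsto (fun n : ℕ ↦
        (∑ j ∈ Finset.range (p ^ n), primeToPow p k (a + m * j)) / (p : ℚ_[p]) ^ n)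
      atTop (𝓝 ((m : ℚ_[p]) ^ k *
        ((((Polynomial.bernoulli k).eval ((a : ℚ) / (m : ℚ)) : ℚ) : ℚ_[p])
          - (p : ℚ_[p]) ^ k / p *
            (((Polynomial.bernoulli k).eval ((a₁ : ℚ) / (m : ℚ)) : ℚ) : ℚ_[p])))) := by
  have hp0 : (p : ℚ_[p]) ≠ 0 := Nat.cast_ne_zero.2 hp.out.ne_zero
  have hm0 : (m : ℚ_[p]) ≠ 0 := Nat.cast_ne_zero.2 hm.ne'
  have hdvd : ∀ j, p ∣ a + m * j ↔ j % p = j₀ := by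
    intro j
    have h1 : p ∣ a + m * j ↔ a + m * j₀ ≡ a + m * j [MOD p] := by
      rw [← h, Nat.ModEq, Nat.mul_mod_right, eq_comm, Nat.dvd_iff_mod_eq_zero]
    have hc : Nat.gcd p m = 1 := (Nat.Prime.coprime_iff_not_dvd hp.out).2 hpm
    rw [h1]
    constructor
    · intro h2
      have := Nat.ModEq.cancel_left_of_coprime hc (Nat.ModEq.add_left_cancel' a h2)
      rw [← this, Nat.mod_eq_of_lt hj₀]
    · intro h2
      refine Nat.ModEq.add_left a (Nat.ModEq.mul_left m ?_)
      rw [Nat.ModEq, h2, Nat.mod_eq_of_lt hj₀]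
  have hsplit : ∀ N, ∑ j ∈ Finset.range (p * N), primeToPow p k (a + m * j) =
      (∑ j ∈ Finset.range (p * N), ((a + m * j : ℕ) : ℚ_[p]) ^ k) -
        ∑ i ∈ Finset.range N, ((p * (a₁ + m * i) : ℕ) : ℚ_[p]) ^ k := by
    intro N
    have h2 := sum_range_mul_ite_mod hj₀ N fun j ↦ ((a + m * j : ℕ) : ℚ_[p]) ^ k
    have h3 : ∀ i, p * (a₁ + m * i) = a + m * (p * i + j₀) := fun i ↦ by
      rw [mul_add, h]; ring
    simp only [h3]
    rw [← h2, ← Finset.sum_sub_distrib]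
    refine Finset.sum_congr rfl fun j _ ↦ ?_
    simp only [primeToPow, hdvd]
    split_ifs <;> simp
  rw [← tendsto_add_atTop_iff_nat 1]
  have hA := (tendsto_add_atTop_iff_nat 1).2
    (tendsto_sum_range_pow_div_bernoulli (p := p) ((a : ℚ) / m) k)
  have hB := tendsto_sum_range_pow_div_bernoulli (p := p) ((a₁ : ℚ) / m) k
  refine ((hA.sub (hB.const_mul ((p : ℚ_[p]) ^ k / p))).const_mul ((m : ℚ_[p]) ^ k)).congr
    fun n ↦ ?_
  have hterm : ∀ b j : ℕ, ((b + m * j : ℕ) : ℚ_[p]) ^ k =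
      (m : ℚ_[p]) ^ k * ((((b : ℚ) / m : ℚ) : ℚ_[p]) + j) ^ k := by
    intro b j
    rw [← mul_pow]
    congr 1
    push_cast
    field_simp
  rw [pow_succ' p n, hsplit]
  simp only [Nat.cast_mul p, mul_pow (p : ℚ_[p]), hterm, ← Finset.mul_sum]
  field_simp
  ring

open Filter Topology in
/-- The regularised Bernoulli measure attached to the progression `a` modulo `m` and an arbitrary
`p`-adic unit `c`, together with its moments over `ℤ_pˣ`. -/
theorem exists_bernoulli_measure (m a : ℕ) (hm : 1 < m) (ha : 0 < a) (ham : a < m)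
    (p : ℕ) [hp : Fact p.Prime] (hpm : ¬ p ∣ m)
    (c : ℤ_[p]ˣ)
    (a₁ : ℕ) (ha₁ : 0 < a₁) (ha₁p : ((a₁ : ℤ) * p) ≡ a [ZMOD (m : ℤ)])
    (ha₁min : ∀ x : ℕ, 0 < x → ((x : ℤ) * p) ≡ a [ZMOD (m : ℤ)] → a₁ ≤ x) :
    ∃ μ : C(ℤ_[p], ℚ_[p]) →ₗ[ℚ_[p]] ℚ_[p],
      (∀ f : C(ℤ_[p], ℚ_[p]), (∀ x : ℤ_[p], ‖f x‖ ≤ 1) → ‖μ f‖ ≤ 1) ∧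
      ∀ k : ℕ, 1 ≤ k → ∀ g : C(ℤ_[p], ℚ_[p]),
        (∀ b : ℤ_[p], g b = if ‖b‖ = 1 then (b : ℚ_[p]) ^ (k - 1) else 0) →
        μ g = (1 - ((c : ℤ_[p]) : ℚ_[p]) ^ k) * (m : ℚ_[p]) ^ (k - 1) *
          ((((Polynomial.bernoulli k).eval ((a : ℚ) / (m : ℚ)) : ℚ) : ℚ_[p]) / (k : ℚ_[p])
            - (p : ℚ_[p]) ^ (k - 1) / (k : ℚ_[p]) *
              (((Polynomial.bernoulli k).eval ((a₁ : ℚ) / (m : ℚ)) : ℚ) : ℚ_[p])) := by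
  obtain ⟨j₀, hj₀, hj₀eq⟩ := exists_mul_eq_add_mul hm ha ham hp.out.pos ha₁ ha₁p ha₁min
  have hp0 : (p : ℚ_[p]) ≠ 0 := Nat.cast_ne_zero.2 hp.out.ne_zero
  have hm0 : (m : ℚ_[p]) ≠ 0 := Nat.cast_ne_zero.2 (by omega)
  have hm1 : ‖(m : ℚ_[p])‖ = 1 :=
    Padic.norm_natCast_eq_one_iff.2 ((Nat.Prime.coprime_iff_not_dvd hp.out).2 hpm)
  choose π t ht using fun n ↦ exists_perm_progression hpm a c n
  let w : ∀ n, ZMod (p ^ n) → ℚ_[p] := fun n z ↦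
    (t n z : ℚ_[p]) / m + (((c : ℤ_[p]) : ℚ_[p]) - 1) / 2
  have hw : ∀ n z, ‖w n z‖ ≤ 1 := fun n z ↦ by
    refine (Padic.nonarchimedean _ _).trans (max_le ?_ (PadicInt.norm_unit_sub_one_div_two_le c))
    rw [norm_div, hm1, div_one]
    exact (t n z).norm_le_one
  let S : ℕ → C(ℤ_[p], ℚ_[p]) →ₗ[ℚ_[p]] ℚ_[p] := fun n ↦
    { toFun := fun f ↦ ∑ z, f ((a + m * z.val : ℕ) : ℤ_[p]) * w n z
      map_add' := fun f g ↦ by simp [add_mul, Finset.sum_add_distrib]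
      map_smul' := fun r f ↦ by simp [Finset.mul_sum, mul_assoc] }
  have hS : ∀ n f (C : ℝ), (∀ x, ‖f x‖ ≤ C) → ‖S n f‖ ≤ C := fun n f C hf ↦ by
    refine IsUltrametricDist.norm_sum_le_of_forall_le_of_nonneg
      ((norm_nonneg _).trans (hf 0)) fun z _ ↦ ?_
    rw [norm_mul]
    exact (mul_le_of_le_one_right (norm_nonneg _) (hw n z)).trans (hf _)
  obtain ⟨μ, hμ, hlim⟩ := exists_integral_limit_functional S hS
  refine ⟨μ, hμ, fun k hk g hg ↦ hlim g _ ?_⟩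
  have hk0 : (k : ℚ_[p]) ≠ 0 := Nat.cast_ne_zero.2 (by omega)
  have hgnat : ∀ x : ℕ, g (x : ℤ_[p]) = primeToPow p (k - 1) x := by
    intro x
    rw [hg, primeToPow]
    have : ‖(x : ℤ_[p])‖ = 1 ↔ ¬ p ∣ x := by
      rw [PadicInt.norm_def, PadicInt.coe_natCast, Padic.norm_natCast_eq_one_iff,
        Nat.Prime.coprime_iff_not_dvd hp.out]
    simp only [this, PadicInt.coe_natCast, ite_not]
  let T : ℕ → ℕ → ℚ_[p] := fun i n ↦
    ∑ j ∈ Finset.range (p ^ n), primeToPow p i (a + m * j)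
  have hTz : ∀ i n, ∑ z : ZMod (p ^ n), primeToPow p i (a + m * z.val) = T i n := fun i n ↦
    ZMod.sum_val_eq_sum_range (p ^ n) fun j ↦ primeToPow p i (a + m * j)
  have hT := fun i ↦ tendsto_sum_range_primeToPow (p := p) (by omega : 0 < m) hpm hj₀ hj₀eq i
  -- the Riemann sum equals the expected main term up to a multiple of `p ^ n`
  have hmain : ∀ n, 1 ≤ n → ∃ e : ℚ_[p], ‖e‖ ≤ 1 ∧
      k * S n g = (1 - ((c : ℤ_[p]) : ℚ_[p]) ^ k) / m * (T k n / (p : ℚ_[p]) ^ n) +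
        k * ((((c : ℤ_[p]) : ℚ_[p]) - 1) / 2) * T (k - 1) n + (p : ℚ_[p]) ^ n * e := by
    intro n hn
    have hterm : ∀ z : ZMod (p ^ n), ∃ e : ℚ_[p], ‖e‖ ≤ 1 ∧
        k * (primeToPow p (k - 1) (a + m * z.val) * w n z) =
          (primeToPow p k (a + m * z.val) - ((c : ℤ_[p]) : ℚ_[p]) ^ k *
            primeToPow p k (a + m * (π n z).val)) / (m * (p : ℚ_[p]) ^ n) +
          k * ((((c : ℤ_[p]) : ℚ_[p]) - 1) / 2) * primeToPow p (k - 1) (a + m * z.val) +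
          (p : ℚ_[p]) ^ n * e := by
      intro z
      have hz := ht n z
      set x : ℕ := a + m * z.val
      set y : ℕ := a + m * (π n z).val
      have hxy : p ∣ x ↔ p ∣ y := by
        rw [← Int.natCast_dvd_natCast, ← Int.natCast_dvd_natCast, ← PadicInt.norm_int_lt_one_iff_dvd,
          ← PadicInt.norm_int_lt_one_iff_dvd, PadicInt.norm_lt_one_iff_dvd,
          PadicInt.norm_lt_one_iff_dvd, Int.cast_natCast, Int.cast_natCast, hz,
          dvd_add_left ((dvd_pow_self _ (by omega)).mul_right _), c.isUnit.dvd_mul_left]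
      by_cases hpx : p ∣ x
      · refine ⟨0, by simp, ?_⟩
        simp [primeToPow, hpx, hxy.1 hpx]
      · obtain ⟨K, hK⟩ := Polynomial.powAddExpansion (x : ℤ_[p]) (-(p ^ n * t n z)) k
        rw [show (x : ℤ_[p]) + -(p ^ n * t n z) = c * y by rw [hz]; ring] at hK
        refine ⟨(K * t n z ^ 2 : ℤ_[p]) / m, ?_, ?_⟩
        · rw [norm_div, hm1, div_one]
          exact PadicInt.norm_le_one _
        · have hK' := congrArg (fun q : ℤ_[p] ↦ (q : ℚ_[p])) hK
          push_cast at hK'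
          simp only [primeToPow, hpx, mt hxy.2 hpx, if_false, w]
          rw [← mul_pow, hK']
          push_cast
          field_simp
          ring
    choose e he hsum using hterm
    refine ⟨∑ z, e z,
      IsUltrametricDist.norm_sum_le_of_forall_le_of_nonneg zero_le_one fun z _ ↦ he z, ?_⟩
    have hSg : S n g = ∑ z, primeToPow p (k - 1) (a + m * z.val) * w n z :=
      Finset.sum_congr rfl fun z _ ↦ by rw [hgnat]
    have hπ : ∑ z, primeToPow p k (a + m * (π n z).val) = T k n :=
      (Equiv.sum_comp (π n) fun z ↦ primeToPow p k (a + m * z.val)).trans (hTz k n)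
    rw [hSg, Finset.mul_sum, Finset.sum_congr rfl fun z _ ↦ hsum z, Finset.sum_add_distrib,
      Finset.sum_add_distrib, ← Finset.mul_sum, ← Finset.mul_sum, ← Finset.sum_div,
      Finset.sum_sub_distrib, ← Finset.mul_sum, hπ, hTz, hTz]
    field_simp
  have hpow := tendsto_padic_pow_atTop_zero (p := p)
  have hT0 : Tendsto (fun n ↦ T (k - 1) n) atTop (𝓝 0) := by
    have := (hT (k - 1)).mul hpow
    rw [mul_zero] at this
    refine this.congr fun n ↦ div_mul_cancel₀ _ (pow_ne_zero n hp0)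
  have herr : Tendsto (fun n ↦ k * S n g -
      ((1 - ((c : ℤ_[p]) : ℚ_[p]) ^ k) / m * (T k n / (p : ℚ_[p]) ^ n) +
        k * ((((c : ℤ_[p]) : ℚ_[p]) - 1) / 2) * T (k - 1) n)) atTop (𝓝 0) := by
    refine squeeze_zero_norm' ?_ (tendsto_norm_zero.comp hpow)
    filter_upwards [eventually_ge_atTop 1] with n hn
    obtain ⟨e, he, heq⟩ := hmain n hn
    rw [heq, add_sub_cancel_left, norm_mul]
    exact mul_le_of_le_one_right (norm_nonneg _) he
  have hfin := ((herr.add (((hT k).const_mul ((1 - ((c : ℤ_[p]) : ℚ_[p]) ^ k) / m)).add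
    (hT0.const_mul (k * ((((c : ℤ_[p]) : ℚ_[p]) - 1) / 2))))).div_const (k : ℚ_[p]))
  obtain ⟨l, rfl⟩ : ∃ l, k = l + 1 := ⟨k - 1, by omega⟩
  convert hfin using 1
  · funext n
    field_simp
    ring
  · congr 1
    simp only [Nat.add_sub_cancel]
    field_simp
    ring


/-- Let `m, a` be coprime integers with `m > 1`, `0 < a < m`, let `p` be a prime
not dividing `m`, and let `σ` be a field automorphism of `ℚ̄` fixing every `m`-th root of unity.
Let `c = χ_p(σ) ∈ ℤ_pˣ` be the value of the `p`-adic cyclotomic character at `σ` (characterised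
by `σ(ζ) = ζ^(c mod pⁿ)` for all `pⁿ`-th roots of unity `ζ`), and let `a₁ = ⟨ap⁻¹⟩` be the least
positive integer with `a₁·p ≡ a (mod m)`.  Then there is a `ℤ_p`-valued measure `μ` on `ℤ_p`
(a `ℚ_p`-linear functional on `C(ℤ_p, ℚ_p)` sending `ℤ_p`-valued functions into `ℤ_p`) such
that for every `k ≥ 1`, `μ` applied to the continuous function `b ↦ b^(k−1)·1_{ℤ_pˣ}(b)`
equals `(1 − c^k)·m^(k−1)·((1/k)·B_k(a/m) − (p^(k−1)/k)·B_k(a₁/m))` in `ℚ_p`. -/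
theorem stmt0 (m a : ℕ) (hm : 1 < m) (ha : 0 < a) (ham : a < m) (hcop : Nat.Coprime a m)
    (p : ℕ) [hp : Fact p.Prime] (hpm : ¬ p ∣ m)
    (σ : AlgebraicClosure ℚ ≃+* AlgebraicClosure ℚ)
    (hσ : ∀ ζ : AlgebraicClosure ℚ, ζ ^ m = 1 → σ ζ = ζ)
    (c : ℤ_[p]ˣ)
    (hc : ∀ (n : ℕ) (ζ : AlgebraicClosure ℚ), ζ ^ (p ^ n) = 1 →
      σ ζ = ζ ^ (PadicInt.toZModPow n (c : ℤ_[p])).val)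
    (a₁ : ℕ) (ha₁ : 0 < a₁) (ha₁p : ((a₁ : ℤ) * p) ≡ a [ZMOD (m : ℤ)])
    (ha₁min : ∀ x : ℕ, 0 < x → ((x : ℤ) * p) ≡ a [ZMOD (m : ℤ)] → a₁ ≤ x) :
    ∃ μ : C(ℤ_[p], ℚ_[p]) →ₗ[ℚ_[p]] ℚ_[p],
      (∀ f : C(ℤ_[p], ℚ_[p]), (∀ x : ℤ_[p], ‖f x‖ ≤ 1) → ‖μ f‖ ≤ 1) ∧
      ∀ k : ℕ, 1 ≤ k → ∀ g : C(ℤ_[p], ℚ_[p]),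
        (∀ b : ℤ_[p], g b = if ‖b‖ = 1 then (b : ℚ_[p]) ^ (k - 1) else 0) →
        μ g = (1 - ((c : ℤ_[p]) : ℚ_[p]) ^ k) * (m : ℚ_[p]) ^ (k - 1) *
          ((((Polynomial.bernoulli k).eval ((a : ℚ) / (m : ℚ)) : ℚ) : ℚ_[p]) / (k : ℚ_[p])
            - (p : ℚ_[p]) ^ (k - 1) / (k : ℚ_[p]) *
              (((Polynomial.bernoulli k).eval ((a₁ : ℚ) / (m : ℚ)) : ℚ) : ℚ_[p])) :=
  exists_bernoulli_measure m a hm ha ham p hpm c a₁ ha₁ ha₁p ha₁min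
end

section
/- Let m and a be coprime integers with m > 1 and 0 < a < m, let p be a prime dividing m, and let σ be a field automorphism of ℚ̄ fixing every m-th root of unity; set c := χ_p(σ) ∈ ℤ_pˣ. Then there exists a ℤ_p-valued measure μ on ℤ_p such that for every integer k ≥ 1, ∫_{ℤ_pˣ} b^{k−1} dμ(b) (i.e., μ applied to the continuous function b ↦ b^{k−1}·1_{ℤ_pˣ}(b)) equals (1 − c^k) · m^{k−1} · (1/k)·B_k(a/m), viewed in ℚ_p. -/
open Filter Topology

/-- A pointwise bounded sequence of linear functionals with values in a proper field has a
linear pointwise limit along any ultrafilter. -/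
lemma exists_linearMap_tendsto_ultrafilter {𝕜 V : Type*} [NontriviallyNormedField 𝕜]
    [ProperSpace 𝕜] [AddCommGroup V] [Module 𝕜 V] (F : Ultrafilter ℕ) (L : ℕ → V →ₗ[𝕜] 𝕜)
    (hL : ∀ f, ∃ C : ℝ, ∀ n, ‖L n f‖ ≤ C) :
    ∃ μ : V →ₗ[𝕜] 𝕜, ∀ f, Tendsto (fun n => L n f) F (𝓝 (μ f)) := by
  have key : ∀ f, ∃ x, Tendsto (fun n => L n f) F (𝓝 x) := by
    intro f
    obtain ⟨C, hC⟩ := hL f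
    obtain ⟨x, -, hx⟩ := (isCompact_closedBall (0 : 𝕜) C).ultrafilter_le_nhds
      (F.map fun n => L n f) (by
        rw [le_principal_iff]
        exact mem_map.2 (univ_mem' fun n => by simpa using hC n))
    exact ⟨x, hx⟩
  choose μ hμ using key
  exact ⟨{ toFun := μ
           map_add' := fun f g => tendsto_nhds_unique (hμ (f + g))
             (by simpa using (hμ f).add (hμ g))
           map_smul' := fun r f => tendsto_nhds_unique (hμ (r • f))
             (by simpa using (hμ f).const_mul r) }, hμ⟩

/-- The sum of the `k`-th powers of an arithmetic progression, in terms of Bernoulli polynomials. -/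
lemma succ_mul_sum_range_add_pow_eq_bernoulli_sub (x : ℚ) (k N : ℕ) :
    ((k : ℚ) + 1) * ∑ j ∈ Finset.range N, (x + j) ^ k =
      (Polynomial.bernoulli (k + 1)).eval (x + N) - (Polynomial.bernoulli (k + 1)).eval x := by
  induction N with
  | zero => simp
  | succ N ih =>
    have h := Polynomial.bernoulli_eval_one_add (k + 1) (x + N)
    rw [Finset.sum_range_succ, mul_add, ih]
    push_cast at h ⊢
    rw [show x + (N + 1) = 1 + (x + N) by ring, h]
    ring

lemma sum_range_add_mul_pow_eq_bernoulli_sub {m : ℕ} (hm : m ≠ 0) (a k N : ℕ) :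
    ((k : ℚ) + 1) * ∑ j ∈ Finset.range N, ((a : ℚ) + m * j) ^ k =
      (m : ℚ) ^ k * ((Polynomial.bernoulli (k + 1)).eval ((a : ℚ) / m + N) -
        (Polynomial.bernoulli (k + 1)).eval ((a : ℚ) / m)) := by
  have hm' : (m : ℚ) ≠ 0 := by exact_mod_cast hm
  rw [← succ_mul_sum_range_add_pow_eq_bernoulli_sub, mul_left_comm,
    Finset.mul_sum (f := fun j : ℕ => ((a : ℚ) / m + j) ^ k)]
  congr 1
  refine Finset.sum_congr rfl fun j _ => ?_
  rw [← mul_pow, mul_add, mul_div_cancel₀ _ hm']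

section Padic

variable {p : ℕ} [hp : Fact p.Prime]

lemma tendsto_padic_prime_pow_nhds_zero :
    Tendsto (fun n : ℕ => (p : ℚ_[p]) ^ n) atTop (𝓝 0) :=
  tendsto_pow_atTop_nhds_zero_of_norm_lt_one Padic.norm_p_lt_one

lemma eval_ratCast_map (P : Polynomial ℚ) (x : ℚ) :
    (P.map (algebraMap ℚ ℚ_[p])).eval (x : ℚ_[p]) = ((P.eval x : ℚ) : ℚ_[p]) := by
  rw [← eq_ratCast (algebraMap ℚ ℚ_[p]) x, Polynomial.eval_map_apply, eq_ratCast]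

/-- The Volkenborn integral of `(a + m z) ^ k` is `m ^ k B_k(a / m)`. -/
lemma tendsto_volkenborn_sum_add_mul_pow {m : ℕ} (hm : m ≠ 0) (a k : ℕ) :
    Tendsto (fun n : ℕ => (∑ j ∈ Finset.range (p ^ n), ((a : ℚ_[p]) + m * j) ^ k) / (p : ℚ_[p]) ^ n)
      atTop (𝓝 ((m : ℚ_[p]) ^ k *
        (((Polynomial.bernoulli k).eval ((a : ℚ) / m) : ℚ) : ℚ_[p]))) := by
  set P : Polynomial ℚ_[p] := (Polynomial.bernoulli (k + 1)).map (algebraMap ℚ ℚ_[p]) with hP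
  set x : ℚ_[p] := (((a : ℚ) / m : ℚ) : ℚ_[p]) with hx
  have hk : (k : ℚ_[p]) + 1 ≠ 0 := by exact_mod_cast k.succ_ne_zero
  have hp0 : (p : ℚ_[p]) ≠ 0 := by exact_mod_cast hp.out.ne_zero
  have hd := (P.hasDerivAt x).tendsto_slope_zero
  have hPd : P.derivative.eval x =
      (k + 1) * (((Polynomial.bernoulli k).eval ((a : ℚ) / m) : ℚ) : ℚ_[p]) := by
    rw [hP, Polynomial.derivative_map, hx, eval_ratCast_map, Polynomial.derivative_bernoulli]
    simp
  have hlim : Tendsto (fun n : ℕ => (p : ℚ_[p]) ^ n) atTop (𝓝[≠] 0) :=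
    tendsto_nhdsWithin_iff.2 ⟨tendsto_padic_prime_pow_nhds_zero,
      Eventually.of_forall fun n => pow_ne_zero n hp0⟩
  have h := (hd.comp hlim).const_mul ((m : ℚ_[p]) ^ k / (k + 1))
  rw [hPd] at h
  convert h using 2 with n
  · have h1 := congrArg (fun q : ℚ => (q : ℚ_[p]))
      (sum_range_add_mul_pow_eq_bernoulli_sub hm a k (p ^ n))
    simp only [Rat.cast_mul, Rat.cast_sub, ← eval_ratCast_map] at h1
    push_cast at h1
    simp only [Function.comp, hP, hx]
    push_cast
    rw [smul_eq_mul, div_mul_eq_mul_div, mul_left_comm, ← h1, div_eq_inv_mul]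
    field_simp
  · field_simp

/-- The affine map of `ℤ_p` induced by multiplication by a unit `c ≡ 1 (mod m)` on `a + m ℤ_p`
permutes residues modulo `p ^ n`. -/
lemma exists_perm_unit_mul_add_eq (c : ℤ_[p]ˣ) {m a : ℕ} (hcm : (m : ℤ_[p]) ∣ (c : ℤ_[p]) - 1) (n : ℕ) :
    ∃ (e : Equiv.Perm (ZMod (p ^ n))) (q : ZMod (p ^ n) → ℤ_[p]), ∀ z,
      (c : ℤ_[p]) * (a + m * (z.val : ℤ_[p])) = (a + m * ((e z).val : ℤ_[p])) + m * p ^ n * q z := by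
  obtain ⟨t, ht⟩ := hcm
  have : NeZero (p ^ n) := ⟨pow_ne_zero n hp.out.ne_zero⟩
  let e : Equiv.Perm (ZMod (p ^ n)) :=
    ((Units.map (PadicInt.toZModPow (p := p) n).toMonoidHom c).mulLeft).trans
      (Equiv.addRight (PadicInt.toZModPow n (a * t)))
  have he : ∀ z, e z = PadicInt.toZModPow n (c : ℤ_[p]) * z + PadicInt.toZModPow n ((a : ℤ_[p]) * t) :=
    fun z => rfl
  have hq : ∀ z : ZMod (p ^ n), ∃ q : ℤ_[p],
      (c : ℤ_[p]) * z.val + a * t - (e z).val = p ^ n * q := by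
    intro z
    rw [← dvd_iff_exists_eq_mul_right, ← Ideal.mem_span_singleton, ← PadicInt.ker_toZModPow,
      RingHom.mem_ker, map_sub, map_add, map_mul, map_natCast, map_natCast, ZMod.natCast_val,
      ZMod.natCast_val, ZMod.cast_id, ZMod.cast_id, he, sub_self]
  choose q hq using hq
  refine ⟨e, q, fun z => ?_⟩
  linear_combination (m : ℤ_[p]) * hq z + (a : ℤ_[p]) * ht

lemma sum_zmod_val_eq_sum_range {M : Type*} [AddCommMonoid M] (N : ℕ) [NeZero N] (f : ℕ → M) :
    ∑ z : ZMod N, f z.val = ∑ j ∈ Finset.range N, f j := by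
  refine Finset.sum_bij (fun z _ => z.val) (fun z _ => Finset.mem_range.2 z.val_lt)
    (fun _ _ _ _ h => ZMod.val_injective N h) (fun j hj => ⟨j, Finset.mem_univ _, ?_⟩)
    (fun _ _ => rfl)
  exact ZMod.val_cast_of_lt (Finset.mem_range.1 hj)

/-- If multiplication by `c` permutes the `x z` up to errors `r * q z`, this compares their `k`-th
power sums up to an error divisible by `r ^ 2`. -/
lemma exists_pow_mul_sum_pow_eq {R ι : Type*} [CommRing R] [Fintype ι] (e : Equiv.Perm ι)
    (x q : ι → R) (c r : R) (h : ∀ z, c * x z = x (e z) + r * q z) (k : ℕ) :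
    ∃ E : R, c ^ k * ∑ z, x z ^ k =
      ∑ z, x z ^ k + k * r * ∑ z, x (e z) ^ (k - 1) * q z + r ^ 2 * E := by
  refine ⟨∑ z, Polynomial.powAddExpansion (x (e z)) (r * q z) k * q z ^ 2, ?_⟩
  rw [← Equiv.sum_comp e fun z => x z ^ k, Finset.mul_sum, Finset.mul_sum,
    ← Finset.sum_add_distrib, Finset.mul_sum, ← Finset.sum_add_distrib,
    Equiv.sum_comp e fun z => c ^ k * x z ^ k]
  refine Finset.sum_congr rfl fun z _ => ?_
  rw [← mul_pow, h]
  linear_combination (Polynomial.powAddExpansion (x (e z)) (r * q z) k).2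

lemma natCast_dvd_sub_one_of_cyclotomic {K : Type*} [Field K] [IsSepClosed K] [CharZero K]
    {m : ℕ} (hm : m ≠ 0) (σ : K → K) (hσ : ∀ ζ : K, ζ ^ m = 1 → σ ζ = ζ) (c : ℤ_[p])
    (hc : ∀ (n : ℕ) (ζ : K), ζ ^ (p ^ n) = 1 → σ ζ = ζ ^ (PadicInt.toZModPow n c).val) :
    (m : ℤ_[p]) ∣ c - 1 := by
  obtain ⟨v, m', hm', rfl⟩ := Nat.exists_eq_pow_mul_and_not_dvd hm p hp.out.ne_one
  have hu : IsUnit (m' : ℤ_[p]) := by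
    rw [PadicInt.isUnit_iff, PadicInt.norm_natCast_eq_one_iff]
    exact (Nat.Prime.coprime_iff_not_dvd hp.out).2 hm'
  have : NeZero (p ^ v) := ⟨pow_ne_zero v hp.out.ne_zero⟩
  have : NeZero ((p ^ v : ℕ) : K) := ⟨by exact_mod_cast pow_ne_zero v hp.out.ne_zero⟩
  obtain ⟨ζ, hζ⟩ := HasEnoughRootsOfUnity.exists_primitiveRoot K (p ^ v)
  have h1 := hc v ζ hζ.pow_eq_one
  rw [hσ ζ (by rw [pow_mul, hζ.pow_eq_one, one_pow])] at h1
  have h2 : PadicInt.toZModPow v c = 1 := by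
    have h3 : (PadicInt.toZModPow v c).val = 1 % p ^ v :=
      hζ.pow_inj (ZMod.val_lt _) (Nat.mod_lt _ (NeZero.pos _))
        (by rw [← h1, ← pow_eq_pow_mod 1 hζ.pow_eq_one, pow_one])
    exact (ZMod.natCast_zmod_val _).symm.trans (by rw [h3, ZMod.natCast_mod, Nat.cast_one])
  push_cast
  rw [hu.mul_right_dvd, ← Ideal.mem_span_singleton,
    ← PadicInt.ker_toZModPow, RingHom.mem_ker, map_sub, h2, map_one, sub_self]

lemma norm_natCast_add_mul_eq_one {m a : ℕ} (hcop : Nat.Coprime a m) (hpm : p ∣ m) (j : ℕ) :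
    ‖(a : ℤ_[p]) + m * (j : ℤ_[p])‖ = 1 := by
  have h : Nat.Coprime p (a + m * j) := by
    obtain ⟨d, rfl⟩ := hpm
    have := (hcop.coprime_mul_right_right).symm
    rw [mul_assoc, Nat.coprime_add_mul_left_right]
    exact this
  simpa using PadicInt.norm_natCast_eq_one_iff.2 h

/-- The Riemann sums of the regularised Bernoulli measure converge on `x ^ (k - 1)`. -/
lemma tendsto_regularized_bernoulli_sum {m : ℕ} (hm : m ≠ 0) (a : ℕ) (c : ℤ_[p])
    (e : ∀ n, Equiv.Perm (ZMod (p ^ n))) (q : ∀ n, ZMod (p ^ n) → ℤ_[p])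
    (h : ∀ n z, c * (a + m * (z.val : ℤ_[p])) =
      (a + m * ((e n z).val : ℤ_[p])) + m * p ^ n * q n z) {k : ℕ} (hk : 1 ≤ k)
    [∀ n, NeZero (p ^ n)] :
    Tendsto (fun n => -∑ z, (((a + m * ((e n z).val : ℤ_[p])) ^ (k - 1) * q n z : ℤ_[p]) : ℚ_[p]))
      atTop (𝓝 ((1 - (c : ℚ_[p]) ^ k) * (m : ℚ_[p]) ^ (k - 1) *
          ((((Polynomial.bernoulli k).eval ((a : ℚ) / (m : ℚ)) : ℚ) : ℚ_[p]) / (k : ℚ_[p])))) := by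
  have hk0 : (k : ℚ_[p]) ≠ 0 := by exact_mod_cast (by omega : k ≠ 0)
  have hm0 : (m : ℚ_[p]) ≠ 0 := by exact_mod_cast hm
  have hp0 : (p : ℚ_[p]) ≠ 0 := by exact_mod_cast hp.out.ne_zero
  choose E hE using fun n => exists_pow_mul_sum_pow_eq (e n)
    (fun z => (a + m * (z.val : ℤ_[p]) : ℤ_[p])) (q n) c (m * p ^ n) (h n) k
  have hE0 : Tendsto (fun n => (p : ℚ_[p]) ^ n * (E n : ℚ_[p])) atTop (𝓝 0) := by
    refine squeeze_zero_norm (fun n => ?_)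
      (tendsto_zero_iff_norm_tendsto_zero.1 (tendsto_padic_prime_pow_nhds_zero (p := p)))
    rw [norm_mul]
    exact mul_le_of_le_one_right (norm_nonneg _) (E n).2
  have hlim := (((tendsto_volkenborn_sum_add_mul_pow (p := p) hm a k).const_mul
    ((1 - (c : ℚ_[p]) ^ k) / (k * m))).add (hE0.const_mul ((m : ℚ_[p]) / k)))
  have hval : ((1 - (c : ℚ_[p]) ^ k) / (k * m)) * ((m : ℚ_[p]) ^ k *
        (((Polynomial.bernoulli k).eval ((a : ℚ) / m) : ℚ) : ℚ_[p])) + ((m : ℚ_[p]) / k) * 0 =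
      (1 - (c : ℚ_[p]) ^ k) * (m : ℚ_[p]) ^ (k - 1) *
        ((((Polynomial.bernoulli k).eval ((a : ℚ) / (m : ℚ)) : ℚ) : ℚ_[p]) / (k : ℚ_[p])) := by
    obtain ⟨l, rfl⟩ := Nat.exists_eq_add_of_le' hk
    rw [Nat.add_sub_cancel, pow_succ (m : ℚ_[p]) l]
    field_simp
    ring
  rw [hval] at hlim
  refine hlim.congr fun n => ?_
  have hEn := congrArg (fun x : ℤ_[p] => (x : ℚ_[p])) (hE n)
  have hS : ∑ j ∈ Finset.range (p ^ n), ((a : ℚ_[p]) + m * j) ^ k =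
      ((∑ z : ZMod (p ^ n), (a + m * (z.val : ℤ_[p])) ^ k : ℤ_[p]) : ℚ_[p]) := by
    rw [sum_zmod_val_eq_sum_range (p ^ n) fun j => (a + m * (j : ℤ_[p])) ^ k]
    rw [PadicInt.coe_sum]
    push_cast
    rfl
  rw [hS, ← PadicInt.coe_sum]
  set S : ℤ_[p] := ∑ z : ZMod (p ^ n), (a + m * (z.val : ℤ_[p])) ^ k
  set T : ℤ_[p] := ∑ z, (a + m * ((e n z).val : ℤ_[p])) ^ (k - 1) * q n z
  push_cast at hEn
  have hpn := pow_ne_zero n hp0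
  field_simp
  linear_combination -hEn

end Padic

/-- Let `m, a` be coprime integers with `m > 1`, `0 < a < m`, let `p` be a prime
dividing `m`, and let `σ` be a field automorphism of `ℚ̄` fixing every `m`-th root of unity.
Let `c = χ_p(σ) ∈ ℤ_pˣ` be the value of the `p`-adic cyclotomic character at `σ` (characterised
by `σ(ζ) = ζ^(c mod pⁿ)` for all `pⁿ`-th roots of unity `ζ`).  Then there is a `ℤ_p`-valued
measure `μ` on `ℤ_p` (a `ℚ_p`-linear functional on `C(ℤ_p, ℚ_p)` sending `ℤ_p`-valued
functions into `ℤ_p`) such that for every `k ≥ 1`, `μ` applied to the continuous function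
`b ↦ b^(k−1)·1_{ℤ_pˣ}(b)` equals `(1 − c^k)·m^(k−1)·(1/k)·B_k(a/m)` in `ℚ_p`. -/
theorem stmt1 (m a : ℕ) (hm : 1 < m) (ha : 0 < a) (ham : a < m) (hcop : Nat.Coprime a m)
    (p : ℕ) [hp : Fact p.Prime] (hpm : p ∣ m)
    (σ : AlgebraicClosure ℚ ≃+* AlgebraicClosure ℚ)
    (hσ : ∀ ζ : AlgebraicClosure ℚ, ζ ^ m = 1 → σ ζ = ζ)
    (c : ℤ_[p]ˣ)
    (hc : ∀ (n : ℕ) (ζ : AlgebraicClosure ℚ), ζ ^ (p ^ n) = 1 →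
      σ ζ = ζ ^ (PadicInt.toZModPow n (c : ℤ_[p])).val) :
    ∃ μ : C(ℤ_[p], ℚ_[p]) →ₗ[ℚ_[p]] ℚ_[p],
      (∀ f : C(ℤ_[p], ℚ_[p]), (∀ x : ℤ_[p], ‖f x‖ ≤ 1) → ‖μ f‖ ≤ 1) ∧
      ∀ k : ℕ, 1 ≤ k → ∀ g : C(ℤ_[p], ℚ_[p]),
        (∀ b : ℤ_[p], g b = if ‖b‖ = 1 then (b : ℚ_[p]) ^ (k - 1) else 0) →
        μ g = (1 - ((c : ℤ_[p]) : ℚ_[p]) ^ k) * (m : ℚ_[p]) ^ (k - 1) *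
          ((((Polynomial.bernoulli k).eval ((a : ℚ) / (m : ℚ)) : ℚ) : ℚ_[p]) / (k : ℚ_[p])) := by
  have : ∀ n, NeZero (p ^ n) := fun n => ⟨pow_ne_zero n hp.out.ne_zero⟩
  have hm0 : m ≠ 0 := by omega
  have hcm := natCast_dvd_sub_one_of_cyclotomic hm0 σ hσ (c : ℤ_[p]) hc
  choose e q h using exists_perm_unit_mul_add_eq (a := a) c hcm
  let L : ℕ → C(ℤ_[p], ℚ_[p]) →ₗ[ℚ_[p]] ℚ_[p] := fun n =>
    { toFun := fun f => -∑ z, f (a + m * ((e n z).val : ℤ_[p])) * (q n z : ℚ_[p])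
      map_add' := fun f g => by
        simp only [ContinuousMap.add_apply, add_mul, Finset.sum_add_distrib, neg_add]
      map_smul' := fun r f => by
        simp only [ContinuousMap.smul_apply, smul_eq_mul, mul_assoc, ← Finset.mul_sum, mul_neg,
          RingHom.id_apply] }
  have hLdef : ∀ n f, L n f = -∑ z, f (a + m * ((e n z).val : ℤ_[p])) * (q n z : ℚ_[p]) :=
    fun _ _ => rfl
  have hbound : ∀ (f : C(ℤ_[p], ℚ_[p])) (C : ℝ), 0 ≤ C → (∀ x, ‖f x‖ ≤ C) →
      ∀ n, ‖L n f‖ ≤ C := by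
    intro f C hC hf n
    rw [hLdef, norm_neg]
    refine IsUltrametricDist.norm_sum_le_of_forall_le_of_nonneg hC fun z _ => ?_
    rw [norm_mul]
    exact (mul_le_of_le_one_right (norm_nonneg _) (q n z).2).trans (hf _)
  obtain ⟨μ, hμ⟩ := exists_linearMap_tendsto_ultrafilter (hyperfilter ℕ) L fun f =>
    ⟨‖f‖, hbound f ‖f‖ (norm_nonneg f) f.norm_coe_le_norm⟩
  refine ⟨μ, fun f hf => le_of_tendsto (hμ f).norm
    (Eventually.of_forall (hbound f 1 zero_le_one hf)), fun k hk g hg => ?_⟩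
  refine tendsto_nhds_unique (hμ g) (((tendsto_regularized_bernoulli_sum hm0 a (c : ℤ_[p]) e q h
    hk).mono_left Nat.hyperfilter_le_atTop).congr fun n => ?_)
  rw [hLdef]
  congr 1
  refine Finset.sum_congr rfl fun z _ => ?_
  rw [hg, if_pos (norm_natCast_add_mul_eq_one hcop hpm _)]
  push_cast
  rfl
end

section
/- Let m > 1 and a be integers with m ∤ a, let p be any prime, and let σ be a field automorphism of ℚ̄ fixing every m-th root of unity; set c := χ_p(σ) ∈ ℤ_pˣ. Then there exists a ℤ_p-valued measure μ on ℤ_p which is supported on the coset a·c + m·ℤ_p (i.e., μ(f) = 0 for every continuous f vanishing identically on a·c + m·ℤ_p) and which satisfies, for every integer k ≥ 2, ∫_{ℤ_p} b^{k−1} dμ(b) = (m^{k−1}/k) · B_k(a/m) · (1 − c^k), viewed in ℚ_p. -/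
namespace PadicInt

open scoped Topology
open PowerSeries

variable {p : ℕ} [hp : Fact p.Prime]

instance instIsBoundedSMulPadic : IsBoundedSMul ℤ_[p] ℚ_[p] :=
  .of_norm_smul_le fun r x ↦ by rw [Algebra.smul_def, norm_mul]; exact le_rfl

lemma fwdDiff_mahlerTerm (a : ℚ_[p]) (n k : ℕ) :
    (fwdDiff 1)^[k] (mahlerTerm a n : C(ℤ_[p], ℚ_[p])) 0 = if k = n then a else 0 := by
  have h0 : Filter.Tendsto (Pi.single n a : ℕ → ℚ_[p]) Filter.atTop (𝓝 0) :=
    tendsto_const_nhds.congr' <| (Filter.eventually_gt_atTop n).mono fun k hk ↦ by simp [hk.ne']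
  have h1 : (mahlerTerm a n : C(ℤ_[p], ℚ_[p])) = mahlerSeries (Pi.single n a) := by
    rw [mahlerSeries, tsum_eq_single n]
    · simp
    · intro m hm
      ext x
      simp [mahlerTerm_apply, hm]
  rw [h1, fwdDiff_mahlerSeries h0, Pi.single_apply]

lemma norm_coeff_mul_fwdDiff_le (G : ℤ_[p]⟦X⟧) (f : C(ℤ_[p], ℚ_[p])) (n : ℕ) :
    ‖((coeff n G : ℤ_[p]) : ℚ_[p]) * (fwdDiff 1)^[n] f 0‖ ≤ ‖(fwdDiff 1)^[n] f 0‖ := by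
  rw [norm_mul]
  exact mul_le_of_le_one_left (norm_nonneg _) (norm_le_one _)

lemma summable_coeff_mul_fwdDiff (G : ℤ_[p]⟦X⟧) (f : C(ℤ_[p], ℚ_[p])) :
    Summable fun n ↦ ((coeff n G : ℤ_[p]) : ℚ_[p]) * (fwdDiff 1)^[n] f 0 := by
  refine NonarchimedeanAddGroup.summable_of_tendsto_cofinite_zero ?_
  rw [Nat.cofinite_eq_atTop]
  exact squeeze_zero_norm (norm_coeff_mul_fwdDiff_le G f)
    (tendsto_zero_iff_norm_tendsto_zero.mp (fwdDiff_tendsto_zero f))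

/-- The linear functional on continuous functions whose Amice transform is a given power series:
it sends the `n`-th Mahler basis function to the `n`-th coefficient. -/
noncomputable def ofAmice : ℤ_[p]⟦X⟧ →ₗ[ℤ_[p]] C(ℤ_[p], ℚ_[p]) →ₗ[ℚ_[p]] ℚ_[p] where
  toFun G :=
    { toFun := fun f ↦ ∑' n, ((coeff n G : ℤ_[p]) : ℚ_[p]) * (fwdDiff 1)^[n] f 0
      map_add' := fun f g ↦ by
        rw [← (summable_coeff_mul_fwdDiff G f).tsum_add (summable_coeff_mul_fwdDiff G g)]
        simp only [ContinuousMap.coe_add, fwdDiff_iter_add, Pi.add_apply, mul_add]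
      map_smul' := fun r f ↦ by
        rw [RingHom.id_apply, smul_eq_mul, ← tsum_mul_left]
        simp only [ContinuousMap.coe_smul, fwdDiff_iter_const_smul, Pi.smul_apply, smul_eq_mul,
          mul_left_comm] }
  map_add' G H := by
    ext f
    simp only [LinearMap.coe_mk, AddHom.coe_mk, LinearMap.add_apply, map_add, coe_add, add_mul]
    exact (summable_coeff_mul_fwdDiff G f).tsum_add (summable_coeff_mul_fwdDiff H f)
  map_smul' r G := by
    ext f
    simp only [LinearMap.coe_mk, AddHom.coe_mk, LinearMap.smul_apply, RingHom.id_apply,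
      PowerSeries.coeff_smul, smul_eq_mul, coe_mul, mul_assoc, tsum_mul_left]
    rfl

lemma ofAmice_apply (G : ℤ_[p]⟦X⟧) (f : C(ℤ_[p], ℚ_[p])) :
    ofAmice G f = ∑' n, ((coeff n G : ℤ_[p]) : ℚ_[p]) * (fwdDiff 1)^[n] f 0 := rfl

lemma norm_ofAmice_le (G : ℤ_[p]⟦X⟧) (f : C(ℤ_[p], ℚ_[p])) : ‖ofAmice G f‖ ≤ ‖f‖ :=
  (IsUltrametricDist.norm_tsum_le _).trans <| ciSup_le fun n ↦
    (norm_coeff_mul_fwdDiff_le G f n).trans (IsUltrametricDist.norm_fwdDiff_iter_apply_le 1 f 0 n)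

lemma continuous_ofAmice (G : ℤ_[p]⟦X⟧) : Continuous (ofAmice G) :=
  AddMonoidHomClass.continuous_of_bound (ofAmice G) 1 fun f ↦ by
    simpa using norm_ofAmice_le G f

lemma ofAmice_mahlerTerm (G : ℤ_[p]⟦X⟧) (a : ℚ_[p]) (n : ℕ) :
    ofAmice G (mahlerTerm a n) = ((coeff n G : ℤ_[p]) : ℚ_[p]) * a := by
  simp_rw [ofAmice_apply, fwdDiff_mahlerTerm]
  rw [tsum_eq_single n (fun k hk ↦ by simp [hk])]
  simp

lemma ofAmice_one (f : C(ℤ_[p], ℚ_[p])) : ofAmice 1 f = f 0 := by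
  rw [ofAmice_apply, tsum_eq_single 0 (fun k hk ↦ by simp [coeff_one, hk])]
  simp

/-- Two continuous linear functionals on continuous functions agree if they agree on the
Mahler basis. -/
lemma continuousLinearMap_ext_mahlerTerm {L L' : C(ℤ_[p], ℚ_[p]) →ₗ[ℚ_[p]] ℚ_[p]}
    (hL : Continuous L) (hL' : Continuous L')
    (h : ∀ a n, L (mahlerTerm a n) = L' (mahlerTerm a n)) : L = L' := by
  ext f
  have h1 := (hasSum_mahler f).map L hL
  have h2 := (hasSum_mahler f).map L' hL'
  have h3 : L ∘ (fun n ↦ mahlerTerm ((fwdDiff 1)^[n] f 0) n) =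
      L' ∘ (fun n ↦ mahlerTerm ((fwdDiff 1)^[n] f 0) n) := funext fun n ↦ h _ _
  rw [h3] at h1
  exact h1.unique h2

/-- Multiplication of the Amice transform by `(1 + X) ^ y` is translation by `y`. -/
lemma ofAmice_binomialSeries_mul (y : ℤ_[p]) (G : ℤ_[p]⟦X⟧) (f : C(ℤ_[p], ℚ_[p])) :
    ofAmice (binomialSeries ℤ_[p] y * G) f = ofAmice G (f.comp (ContinuousMap.addLeft y)) := by
  have key : ofAmice (binomialSeries ℤ_[p] y * G) =
      ofAmice G ∘ₗ (ContinuousMap.compRightAlgHom ℚ_[p] ℚ_[p]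
        (ContinuousMap.addLeft y)).toLinearMap := by
    refine continuousLinearMap_ext_mahlerTerm (continuous_ofAmice _)
      ((continuous_ofAmice G).comp (ContinuousMap.continuous_precomp _)) fun a n ↦ ?_
    have h : (mahlerTerm a n : C(ℤ_[p], ℚ_[p])).comp (ContinuousMap.addLeft y) =
        ∑ ij ∈ Finset.HasAntidiagonal.antidiagonal n, mahlerTerm ((Ring.choose y ij.1 : ℤ_[p]) * a) ij.2 := by
      ext x
      simp only [ContinuousMap.comp_apply, ContinuousMap.coe_addLeft, mahlerTerm_apply,
        mahler_apply, Ring.add_choose_eq n (Commute.all y x), ContinuousMap.coe_sum,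
        Finset.sum_apply, Finset.sum_smul, mul_smul]
      refine Finset.sum_congr rfl fun ij _ ↦ ?_
      rw [smul_comm]
      rfl
    change _ = ofAmice G (ContinuousMap.comp _ _)
    rw [h, map_sum, ofAmice_mahlerTerm, coeff_mul]
    simp only [ofAmice_mahlerTerm, binomialSeries_coeff, smul_eq_mul, mul_one]
    rw [coe_sum, Finset.sum_mul]
    exact Finset.sum_congr rfl fun ij _ ↦ by rw [coe_mul]; ring
  rw [key]
  rfl

/-- The function `x ↦ (a + m x) ^ j`. -/
noncomputable def affinePow (a m : ℤ_[p]) (j : ℕ) : C(ℤ_[p], ℚ_[p]) :=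
  ⟨fun x ↦ ((a + m * x : ℤ_[p]) : ℚ_[p]) ^ j, by fun_prop⟩

lemma affinePow_apply (a m x : ℤ_[p]) (j : ℕ) :
    affinePow a m j x = ((a + m * x : ℤ_[p]) : ℚ_[p]) ^ j := rfl

/-- The exponential generating function of the moments `∫ (a + m x) ^ j`, as a function of the
Amice transform. -/
noncomputable def momentSeries (a m : ℤ_[p]) : ℤ_[p]⟦X⟧ →ₗ[ℤ_[p]] ℚ_[p]⟦X⟧ where
  toFun G := PowerSeries.mk fun j ↦ ofAmice G (affinePow a m j) / (j.factorial : ℚ_[p])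
  map_add' G H := by ext; simp [add_div]
  map_smul' r G := by
    ext j
    rw [PowerSeries.coeff_mk, map_smul, LinearMap.smul_apply, smul_div_assoc]
    simp

lemma coeff_momentSeries (a m : ℤ_[p]) (G : ℤ_[p]⟦X⟧) (j : ℕ) :
    coeff j (momentSeries a m G) = ofAmice G (affinePow a m j) / (j.factorial : ℚ_[p]) := by
  simp [momentSeries]

lemma momentSeries_one (a m : ℤ_[p]) :
    momentSeries a m 1 = rescale (a : ℚ_[p]) (exp ℚ_[p]) := by
  ext j
  simp [coeff_momentSeries, ofAmice_one, affinePow_apply, coeff_rescale, coeff_exp, div_eq_mul_inv]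

lemma momentSeries_binomialSeries_mul (a m y : ℤ_[p]) (G : ℤ_[p]⟦X⟧) :
    momentSeries a m (binomialSeries ℤ_[p] y * G) =
      rescale ((m * y : ℤ_[p]) : ℚ_[p]) (exp ℚ_[p]) * momentSeries a m G := by
  ext j
  rw [coeff_momentSeries, ofAmice_binomialSeries_mul, coeff_mul]
  have h : (affinePow a m j).comp (ContinuousMap.addLeft y) =
      ∑ ij ∈ Finset.HasAntidiagonal.antidiagonal j, (((m * y : ℤ_[p]) : ℚ_[p]) ^ ij.1 * (j.choose ij.1 : ℚ_[p])) •
        affinePow a m ij.2 := by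
    ext x
    simp only [ContinuousMap.comp_apply, ContinuousMap.coe_addLeft, affinePow_apply,
      ContinuousMap.coe_sum, Finset.sum_apply, ContinuousMap.coe_smul, Pi.smul_apply, smul_eq_mul]
    rw [show a + m * (y + x) = m * y + (a + m * x) by ring, coe_add,
      (Commute.all _ _).add_pow']
    exact Finset.sum_congr rfl fun ij _ ↦ by rw [nsmul_eq_mul]; ring
  rw [h, map_sum, Finset.sum_div]
  refine Finset.sum_congr rfl fun ij hij ↦ ?_
  rw [map_smul, coeff_momentSeries, coeff_rescale, coeff_exp, smul_eq_mul]
  rw [Finset.HasAntidiagonal.mem_antidiagonal] at hij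
  have h1 : (j.choose ij.1 : ℚ_[p]) = j.factorial / (ij.1.factorial * ij.2.factorial) := by
    rw [← hij, Nat.cast_add_choose]
  rw [h1]
  have := j.factorial_ne_zero
  simp only [one_div, map_inv₀, map_natCast]
  field_simp


/-- Integrality of `1 / X - c (1 + X) ^ e / ((1 + X) ^ c - 1)`. -/
lemma exists_amiceTransform (c : ℤ_[p]ˣ) (e : ℤ_[p]) :
    ∃ G : ℤ_[p]⟦X⟧, (binomialSeries ℤ_[p] (c : ℤ_[p]) - 1) * ((binomialSeries ℤ_[p] (1 : ℤ_[p]) - 1) * G) =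
      (binomialSeries ℤ_[p] (c : ℤ_[p]) - 1) -
        (c : ℤ_[p]) • (binomialSeries ℤ_[p] e * (binomialSeries ℤ_[p] (1 : ℤ_[p]) - 1)) := by
  have h1 : binomialSeries ℤ_[p] (1 : ℤ_[p]) - 1 = X := by
    have := binomialSeries_nat (R := ℤ_[p]) (A := ℤ_[p]) 1
    rw [Nat.cast_one] at this
    rw [this]; ring
  obtain ⟨H, hH⟩ : (X : ℤ_[p]⟦X⟧) ∣ binomialSeries ℤ_[p] (c : ℤ_[p]) - 1 := by
    rw [X_dvd_iff]; simp
  have hH0 : constantCoeff H = c := by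
    rw [← coeff_zero_eq_constantCoeff_apply, ← coeff_succ_X_mul, ← hH]
    simp [coeff_one]
  have hinv := mul_invOfUnit H c hH0
  obtain ⟨G, hG⟩ : (X : ℤ_[p]⟦X⟧) ∣
      1 - C (c : ℤ_[p]) * binomialSeries ℤ_[p] e * invOfUnit H c := by
    rw [X_dvd_iff]; simp
  refine ⟨G, ?_⟩
  rw [h1, hH, smul_eq_C_mul]
  linear_combination (-X * H) * hG - X * C (c : ℤ_[p]) * binomialSeries ℤ_[p] e * hinv

lemma rescale_exp_sub_one_ne_zero {r : ℚ_[p]} (hr : r ≠ 0) :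
    rescale r (exp ℚ_[p]) - 1 ≠ 0 := fun h ↦ by
  have := congrArg (coeff 1) h
  simp [coeff_rescale, coeff_exp, coeff_one, hr] at this

/-- The generating function of the values `m ^ k B_k(a / m) / k!`. -/
lemma rescale_bernoulli_generating_function (a m : ℚ_[p]) (hm : m ≠ 0) :
    rescale m (PowerSeries.mk fun n ↦ Polynomial.aeval (a / m)
      ((1 / n.factorial : ℚ) • Polynomial.bernoulli n)) * (rescale m (exp ℚ_[p]) - 1) =
      C m * X * rescale a (exp ℚ_[p]) := by
  have h := congrArg (rescale m) (Polynomial.bernoulli_generating_function (a / m))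
  simpa only [map_mul, map_sub, map_one, rescale_X, rescale_rescale, div_mul_cancel₀ _ hm] using h

/-- If `a c = a + m e`, there is a bounded measure whose pushforward under `x ↦ a + m x` has the
twisted Bernoulli values as moments. -/
lemma exists_ofAmice_affinePow (a m e : ℤ_[p]) (hm : m ≠ 0) (c : ℤ_[p]ˣ)
    (hc : a * c = a + m * e) :
    ∃ G : ℤ_[p]⟦X⟧, ∀ j : ℕ, ofAmice G (affinePow a m j) =
      (m : ℚ_[p]) ^ j / ((j + 1 : ℕ) : ℚ_[p]) *
        Polynomial.aeval ((a : ℚ_[p]) / (m : ℚ_[p])) (Polynomial.bernoulli (j + 1)) *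
        (1 - ((c : ℤ_[p]) : ℚ_[p]) ^ (j + 1)) := by
  obtain ⟨G, hG⟩ := exists_amiceTransform c e
  refine ⟨G, fun j ↦ ?_⟩
  have hm' : (m : ℚ_[p]) ≠ 0 := by simpa using hm
  have hc' : ((c : ℤ_[p]) : ℚ_[p]) ≠ 0 := by simp
  set B := PowerSeries.mk fun n ↦ Polynomial.aeval ((a : ℚ_[p]) / (m : ℚ_[p]))
      ((1 / n.factorial : ℚ) • Polynomial.bernoulli n) with hB
  have hM := congrArg (momentSeries a m) hG
  have e1 (y : ℤ_[p]) (F : ℤ_[p]⟦X⟧) : momentSeries a m ((binomialSeries ℤ_[p] y - 1) * F) =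
      (rescale ((m * y : ℤ_[p]) : ℚ_[p]) (exp ℚ_[p]) - 1) * momentSeries a m F := by
    rw [sub_mul, map_sub, momentSeries_binomialSeries_mul, one_mul, sub_mul, one_mul]
  have e2 (y : ℤ_[p]) : momentSeries a m (binomialSeries ℤ_[p] y - 1) =
      (rescale ((m * y : ℤ_[p]) : ℚ_[p]) (exp ℚ_[p]) - 1) * rescale (a : ℚ_[p]) (exp ℚ_[p]) := by
    rw [← momentSeries_one a m, ← e1, mul_one]
  have e3 (F : ℤ_[p]⟦X⟧) : momentSeries a m ((c : ℤ_[p]) • F) =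
      C ((c : ℤ_[p]) : ℚ_[p]) * momentSeries a m F := by
    rw [map_smul]
    ext n
    rw [coeff_C_mul]
    rfl
  rw [e1, e1, map_sub, e2, e3, momentSeries_binomialSeries_mul, e2, mul_one] at hM
  have b1 := rescale_bernoulli_generating_function (a : ℚ_[p]) (m : ℚ_[p]) hm'
  rw [← hB] at b1
  have b2 := congrArg (rescale ((c : ℤ_[p]) : ℚ_[p])) b1
  have hac : (a : ℚ_[p]) * ((c : ℤ_[p]) : ℚ_[p]) = ((m * e : ℤ_[p]) : ℚ_[p]) + (a : ℚ_[p]) := by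
    rw [← coe_mul, hc, coe_add, add_comm]
  have hC : rescale ((c : ℤ_[p]) : ℚ_[p]) (C (m : ℚ_[p])) = C (m : ℚ_[p]) := by
    ext n
    rcases n with _ | n <;> simp [coeff_rescale, coeff_C]
  simp only [map_mul, map_sub, map_one, rescale_X, rescale_rescale, hC] at b2
  rw [hac, ← exp_mul_exp_eq_exp_add] at b2
  rw [coe_mul m c] at hM
  have hfun : rescale (m : ℚ_[p]) B - rescale (((m : ℚ_[p]) * ((c : ℤ_[p]) : ℚ_[p]))) B =
      C (m : ℚ_[p]) * X * momentSeries a m G := by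
    refine mul_right_cancel₀ (mul_ne_zero (rescale_exp_sub_one_ne_zero hm')
      (rescale_exp_sub_one_ne_zero (mul_ne_zero hm' hc'))) ?_
    linear_combination
      (rescale (((m : ℚ_[p]) * ((c : ℤ_[p]) : ℚ_[p]))) (exp ℚ_[p]) - 1) * b1
      - (rescale (m : ℚ_[p]) (exp ℚ_[p]) - 1) * b2 - C (m : ℚ_[p]) * X * hM
  have hj := congrArg (coeff (j + 1)) hfun
  rw [mul_assoc, map_sub, coeff_rescale, coeff_rescale, coeff_C_mul, coeff_succ_X_mul,
    coeff_momentSeries, hB, PowerSeries.coeff_mk, map_smul, Rat.smul_def, mul_pow] at hj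
  have hf : ((j.factorial : ℕ) : ℚ_[p]) ≠ 0 := by exact_mod_cast j.factorial_ne_zero
  have hj1 : ((j : ℚ_[p]) + 1) ≠ 0 := by exact_mod_cast j.succ_ne_zero
  rw [Nat.factorial_succ] at hj
  push_cast at hj ⊢
  field_simp at hj ⊢
  apply mul_left_cancel₀ hm'
  linear_combination -hj

/-- If `σ` fixes the `m`-th roots of unity and acts on `p`-power roots of unity through `c`, then
`c ≡ 1` modulo `m ℤ_p`. -/
lemma natCast_dvd_sub_one_of_fixes_rootsOfUnity {K : Type*} [Field K] [IsAlgClosed K] [CharZero K]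
    (σ : K ≃+* K) {m : ℕ} (hm : m ≠ 0) (hσ : ∀ ζ : K, ζ ^ m = 1 → σ ζ = ζ) (c : ℤ_[p])
    (hc : ∀ (n : ℕ) (ζ : K), ζ ^ (p ^ n) = 1 → σ ζ = ζ ^ (toZModPow n c).val) :
    (m : ℤ_[p]) ∣ c - 1 := by
  obtain ⟨v, m', hm', rfl⟩ := Nat.exists_eq_pow_mul_and_not_dvd hm p hp.out.ne_one
  have hu : IsUnit (m' : ℤ_[p]) := by
    rw [isUnit_iff]
    exact (norm_natCast_eq_one_iff).mpr ((Nat.Prime.coprime_iff_not_dvd hp.out).mpr hm')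
  have : NeZero (p ^ v) := ⟨pow_ne_zero _ hp.out.ne_zero⟩
  obtain ⟨ζ, hζ⟩ := HasEnoughRootsOfUnity.exists_primitiveRoot K (p ^ v)
  have h1 : ζ ^ (toZModPow v c).val = ζ ^ 1 := by
    rw [← hc v ζ hζ.pow_eq_one, hσ ζ (by rw [pow_mul, hζ.pow_eq_one, one_pow]), pow_one]
  have h2 : (toZModPow v c) = 1 := by
    have := (hζ.isOfFinOrder (pow_ne_zero _ hp.out.ne_zero)).pow_eq_pow_iff_modEq.mp h1
    rw [← hζ.eq_orderOf] at this
    simpa using (ZMod.natCast_eq_natCast_iff _ _ _).mpr this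
  have h3 : c - 1 ∈ Ideal.span {(p : ℤ_[p]) ^ v} := by
    rw [← ker_toZModPow, RingHom.mem_ker, map_sub, h2, map_one, sub_self]
  rw [Ideal.mem_span_singleton] at h3
  push_cast
  exact hu.mul_right_dvd.mpr h3

end PadicInt

/-- Let `m > 1` and `a` be integers with `m ∤ a`, let `p` be any prime, and let
`σ` be a field automorphism of `ℚ̄` fixing every `m`-th root of unity.  Let `c = χ_p(σ) ∈ ℤ_pˣ`
be the value of the `p`-adic cyclotomic character at `σ` (characterised by
`σ(ζ) = ζ^(c mod pⁿ)` for all `pⁿ`-th roots of unity `ζ`).  Then there is a `ℤ_p`-valued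
measure `μ` on `ℤ_p` (a `ℚ_p`-linear functional on `C(ℤ_p, ℚ_p)` sending `ℤ_p`-valued
functions into `ℤ_p`) supported on the coset `a·c + m·ℤ_p` (i.e. `μ f = 0` whenever `f`
vanishes identically on that coset), such that for every `k ≥ 2`,
`∫_{ℤ_p} b^(k−1) dμ(b) = (m^(k−1)/k)·B_k(a/m)·(1 − c^k)` in `ℚ_p`. -/
theorem stmt2 (m : ℕ) (a : ℤ) (hm : 1 < m) (ha : ¬ (m : ℤ) ∣ a)
    (p : ℕ) [hp : Fact p.Prime]
    (σ : AlgebraicClosure ℚ ≃+* AlgebraicClosure ℚ)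
    (hσ : ∀ ζ : AlgebraicClosure ℚ, ζ ^ m = 1 → σ ζ = ζ)
    (c : ℤ_[p]ˣ)
    (hc : ∀ (n : ℕ) (ζ : AlgebraicClosure ℚ), ζ ^ (p ^ n) = 1 →
      σ ζ = ζ ^ (PadicInt.toZModPow n (c : ℤ_[p])).val) :
    ∃ μ : C(ℤ_[p], ℚ_[p]) →ₗ[ℚ_[p]] ℚ_[p],
      (∀ f : C(ℤ_[p], ℚ_[p]), (∀ x : ℤ_[p], ‖f x‖ ≤ 1) → ‖μ f‖ ≤ 1) ∧
      (∀ f : C(ℤ_[p], ℚ_[p]),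
        (∀ t : ℤ_[p], f ((a : ℤ_[p]) * (c : ℤ_[p]) + (m : ℤ_[p]) * t) = 0) → μ f = 0) ∧
      ∀ k : ℕ, 2 ≤ k →
        μ ⟨fun b : ℤ_[p] => (b : ℚ_[p]) ^ (k - 1), by fun_prop⟩
          = (m : ℚ_[p]) ^ (k - 1) / (k : ℚ_[p]) *
              (((Polynomial.bernoulli k).eval ((a : ℚ) / (m : ℚ)) : ℚ) : ℚ_[p]) *
              (1 - ((c : ℤ_[p]) : ℚ_[p]) ^ k) := by
  have hm0 : m ≠ 0 := by omega
  obtain ⟨d, hd⟩ := PadicInt.natCast_dvd_sub_one_of_fixes_rootsOfUnity σ hm0 hσ (c : ℤ_[p]) hc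
  have hac : (a : ℤ_[p]) * c = a + m * (a * d) := by
    linear_combination (a : ℤ_[p]) * hd
  obtain ⟨G, hG⟩ := PadicInt.exists_ofAmice_affinePow (a : ℤ_[p]) (m : ℤ_[p]) (a * d)
    (by exact_mod_cast hm0) c hac
  let φ : C(ℤ_[p], ℤ_[p]) := ⟨fun x ↦ a + m * x, by fun_prop⟩
  refine ⟨PadicInt.ofAmice G ∘ₗ (ContinuousMap.compRightAlgHom ℚ_[p] ℚ_[p] φ).toLinearMap,
    fun f hf ↦ ?_, fun f hf ↦ ?_, fun k hk ↦ ?_⟩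
  · exact (PadicInt.norm_ofAmice_le G (f.comp φ)).trans
      ((ContinuousMap.norm_le _ zero_le_one).mpr fun x ↦ hf _)
  · have : f.comp φ = 0 := by
      ext x
      have := hf (x - a * d)
      rwa [hac, show (a : ℤ_[p]) + m * (a * d) + m * (x - a * d) = a + m * x by ring] at this
    change PadicInt.ofAmice G (f.comp φ) = 0
    rw [this, map_zero]
  · obtain ⟨j, rfl⟩ : ∃ j, k = j + 1 := ⟨k - 1, by omega⟩
    refine (hG j).trans ?_
    have : Polynomial.aeval ((a : ℚ_[p]) / (m : ℚ_[p])) (Polynomial.bernoulli (j + 1)) =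
        (((Polynomial.bernoulli (j + 1)).eval ((a : ℚ) / (m : ℚ)) : ℚ) : ℚ_[p]) := by
      have h := Polynomial.aeval_algebraMap_apply ℚ_[p] ((a : ℚ) / (m : ℚ))
        (Polynomial.bernoulli (j + 1))
      simpa using h
    simp only [PadicInt.coe_intCast, PadicInt.coe_natCast, this, Nat.add_sub_cancel]
end

section
/- Let p be a prime; set q := p if p is odd and q := 4 if p = 2, and set e := φ(q) (so e = p − 1 for odd p and e = 2 for p = 2). Then for every integer β, the set of positive integers congruent to β modulo e, viewed inside ℤ_p via the canonical map ℤ → ℤ_p, is dense in the subset β + (q/p)·ℤ_p of ℤ_p (in particular, for odd p it is dense in ℤ_p itself). -/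
/-- with `q = p` (`p` odd) or `q = 4` (`p = 2`) and `e = φ(q)`, for every
integer `β` the set of positive integers `≡ β (mod e)`, viewed in `ℤ_p`, is dense in the
coset `β + (q/p)·ℤ_p`. -/
theorem stmt10 (p : ℕ) [hp : Fact p.Prime] (q : ℕ) (hq : q = if p = 2 then 4 else p)
    (e : ℕ) (he : e = Nat.totient q) (β : ℤ) :
    {x : ℤ_[p] | ∃ t : ℤ_[p], x = (β : ℤ_[p]) + ((q / p : ℕ) : ℤ_[p]) * t}
      ⊆ closure ((fun k : ℤ => (k : ℤ_[p])) ''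
        {k : ℤ | 0 < k ∧ k ≡ β [ZMOD (e : ℤ)]}) := by
  have hp0 : 0 < p := hp.out.pos
  have he0 : 0 < e := by
    rw [he, Nat.totient_pos, hq]
    split_ifs <;> omega
  have hdvd : ∀ n : ℕ, (e : ℤ) ∣ ((q / p : ℕ) : ℤ) * (1 - (p : ℤ) ^ n) := by
    intro n
    by_cases h2 : p = 2
    · have h4 : Nat.totient 4 = 2 := by decide
      subst h2
      simp [he, hq, h4]
    · rw [if_neg h2] at hq
      subst hq
      rw [he, Nat.totient_prime hp.out, Nat.div_self hp0, Nat.cast_sub hp.out.one_le]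
      have h := sub_dvd_pow_sub_pow (q : ℤ) 1 n
      rw [one_pow] at h
      simpa using (dvd_neg.mpr h)
  rintro x ⟨t, rfl⟩
  rw [Metric.mem_closure_iff]
  intro ε hε
  obtain ⟨n, hn⟩ := PadicInt.exists_pow_neg_lt p hε
  obtain ⟨u, hu⟩ := Ideal.mem_span_singleton.mp (PadicInt.appr_spec n t)
  set c : ℕ := q / p
  set m : ℕ := t.appr n
  set a : ℤ := β + c * (1 - (p : ℤ) ^ n) * m with ha
  set N : ℤ := |a| + 1 with hN
  refine ⟨_, ⟨a + N * ((p : ℤ) ^ n * e), ⟨?_, ?_⟩, rfl⟩, ?_⟩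
  · have h1 : (1 : ℤ) ≤ (p : ℤ) ^ n * e := by
      have : 0 < (p : ℤ) ^ n * e := by positivity
      omega
    have h2 : 0 < N := by positivity
    nlinarith [neg_abs_le a]
  · refine (Int.modEq_iff_dvd.mpr ?_).symm
    obtain ⟨d, hd⟩ := hdvd n
    exact ⟨d * m + N * (p : ℤ) ^ n, by rw [ha, hd]; ring⟩
  · rw [dist_eq_norm]
    refine lt_of_le_of_lt ?_ hn
    rw [PadicInt.norm_le_pow_iff_mem_span_pow, Ideal.mem_span_singleton]
    refine ⟨c * u + c * m - N * e, ?_⟩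
    rw [ha]
    push_cast
    linear_combination (c : ℤ_[p]) * hu
end
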